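/- arXiv:0705.0715 — 3 statements merged into one kernel-verified Lean document; each statement's English description precedes it below -/
import Mathlib

section
/- There is a positive constant δ such that for every finite field F_q of order q and every nonempty finite subset A of F_q, max{|A+A|, |A·A|} ≥ |A| · min{ δ·(|A|²/q)^(1/4), δ·(q/|A|)^(1/3) }, where all cardinalities and the arithmetic are interpreted in the real numbers. -/
open Finset Pointwise

/-- The number of pairs `l = (a, b)` in `L` whose line `y = a * (x - b)` passes through `p`,
as a real number. -/
noncomputable def lineCount {F : Type*} [Field F] [DecidableEq F]
    (L : Finset (F × F)) (p : F × F) : ℝ :=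
  ∑ l ∈ L, if p.2 = l.1 * (p.1 - l.2) then 1 else 0

lemma card_mul_card_le_sum_lineCount {F : Type*} [Field F] [DecidableEq F]
    (A B : Finset F) (hB : B ⊆ A) :
    (#(B ×ˢ A) * #A : ℝ) ≤ ∑ p ∈ (A + A) ×ˢ (A * A), lineCount (B ×ˢ A) p := by
  simp only [lineCount]
  rw [sum_comm, ← nsmul_eq_mul]
  refine card_nsmul_le_sum _ _ _ fun l hl => ?_
  obtain ⟨ha, hb⟩ := mem_product.1 hl
  rw [sum_boole]
  norm_cast
  refine card_le_card_of_injOn (fun c => (l.2 + c, l.1 * c)) (fun c hc => ?_) ?_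
  · have hc' : c ∈ A := hc
    simp [add_mem_add hb hc', mul_mem_mul (hB ha) hc']
  · intro c _ d _ h
    simpa using congrArg Prod.fst h

section Incidence

variable {F : Type*} [Field F] [Fintype F] [DecidableEq F]

lemma sum_lineCount (L : Finset (F × F)) :
    ∑ p, lineCount L p = Fintype.card F * #L := by
  simp only [lineCount]
  rw [sum_comm]
  simp only [Fintype.sum_prod_type, sum_ite_eq', mem_univ, if_true, sum_const,
    card_univ, nsmul_eq_mul, mul_one]
  ring

lemma sum_ite_lines_agree_le {l m : F × F} (hl : l.1 ≠ 0) :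
    ∑ x : F, (if l.1 * (x - l.2) = m.1 * (x - m.2) then (1 : ℝ) else 0)
      ≤ 1 + if l = m then (Fintype.card F : ℝ) else 0 := by
  rw [sum_boole]
  split_ifs with h
  · have : #{x : F | l.1 * (x - l.2) = m.1 * (x - m.2)} ≤ Fintype.card F := card_le_univ _
    have : (#{x : F | l.1 * (x - l.2) = m.1 * (x - m.2)} : ℝ) ≤ Fintype.card F := by
      exact_mod_cast this
    linarith
  · rw [add_zero]
    norm_cast
    rw [card_le_one]
    intro x hx y hy
    simp only [mem_filter, mem_univ, true_and] at hx hy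
    by_contra hxy
    have hslope : l.1 = m.1 := by
      have : (l.1 - m.1) * (x - y) = 0 := by linear_combination hx - hy
      rcases mul_eq_zero.1 this with h' | h'
      · exact sub_eq_zero.1 h'
      · exact absurd (sub_eq_zero.1 h') hxy
    rw [← hslope] at hx
    have := mul_left_cancel₀ hl hx
    exact h (Prod.ext hslope (by linear_combination -this))

lemma sum_lineCount_sq_le {L : Finset (F × F)} (hL : ∀ l ∈ L, l.1 ≠ 0) :
    ∑ p, lineCount L p ^ 2 ≤ (#L : ℝ) ^ 2 + Fintype.card F * #L := by
  calc ∑ p, lineCount L p ^ 2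
      = ∑ l ∈ L, ∑ m ∈ L, ∑ x : F,
          (if l.1 * (x - l.2) = m.1 * (x - m.2) then (1 : ℝ) else 0) := by
        simp only [lineCount, sq, sum_mul_sum]
        rw [sum_comm]
        refine sum_congr rfl fun l _ => ?_
        rw [sum_comm]
        refine sum_congr rfl fun m _ => ?_
        rw [Fintype.sum_prod_type]
        refine sum_congr rfl fun x _ => ?_
        simp [eq_comm]
    _ ≤ ∑ l ∈ L, ∑ m ∈ L, (1 + if l = m then (Fintype.card F : ℝ) else 0) :=
        sum_le_sum fun l hl => sum_le_sum fun m _ => sum_ite_lines_agree_le (hL l hl)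
    _ = (#L : ℝ) ^ 2 + Fintype.card F * #L := by
        simp only [sum_add_distrib, sum_const, nsmul_eq_mul, mul_one, sum_ite_eq]
        rw [sum_ite_mem, inter_self, sum_const, nsmul_eq_mul]
        ring

lemma sq_incidences_sub_mean_le {L : Finset (F × F)} (hL : ∀ l ∈ L, l.1 ≠ 0)
    (P : Finset (F × F)) :
    (∑ p ∈ P, lineCount L p - #P * #L / Fintype.card F) ^ 2
      ≤ #P * (Fintype.card F * #L) := by
  have hq : (Fintype.card F : ℝ) ≠ 0 := by exact_mod_cast Fintype.card_ne_zero
  set c : ℝ := #L / Fintype.card F with hc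
  have hvar : ∑ p, (lineCount L p - c) ^ 2 ≤ Fintype.card F * #L := by
    have hexp : ∑ p, (lineCount L p - c) ^ 2 =
        ∑ p, lineCount L p ^ 2 - 2 * c * ∑ p, lineCount L p
          + (Fintype.card F : ℝ) ^ 2 * c ^ 2 := by
      simp only [sub_sq, sum_add_distrib, sum_sub_distrib, sum_const, mul_sum, card_univ,
        Fintype.card_prod, nsmul_eq_mul, Nat.cast_mul]
      congr 1
      · congr 1
        exact sum_congr rfl fun p _ => by ring
      · ring
    have hcq : Fintype.card F * c = #L := by rw [hc]; field_simp
    rw [hexp, sum_lineCount, ← mul_pow, hcq]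
    have h := sum_lineCount_sq_le hL
    have : 2 * c * (Fintype.card F * #L) = 2 * (#L : ℝ) ^ 2 := by
      linear_combination 2 * (#L : ℝ) * hcq
    linarith
  calc (∑ p ∈ P, lineCount L p - #P * #L / Fintype.card F) ^ 2
      = (∑ p ∈ P, (lineCount L p - c)) ^ 2 := by
        rw [sum_sub_distrib, sum_const, nsmul_eq_mul, hc, mul_div_assoc]
    _ ≤ #P * ∑ p ∈ P, (lineCount L p - c) ^ 2 := sq_sum_le_card_mul_sum_sq
    _ ≤ #P * ∑ p, (lineCount L p - c) ^ 2 := by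
        gcongr
        exact subset_univ P
    _ ≤ #P * (Fintype.card F * #L) := by gcongr

lemma min_le_card_add_mul_card_mul {A : Finset F} (hA : 2 ≤ #A) :
    Fintype.card F * #A / 2 ≤ (#(A + A) * #(A * A) : ℝ) ∨
      (#A : ℝ) ^ 4 / (8 * Fintype.card F) ≤ #(A + A) * #(A * A) := by
  have hq : (0 : ℝ) < Fintype.card F := by exact_mod_cast Fintype.card_pos
  have hcard : (#A : ℝ) / 2 ≤ #(A.erase 0) := by
    have h := pred_card_le_card_erase (s := A) (a := (0 : F))
    have h' : #A ≤ 2 * #(A.erase 0) := by omega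
    have h'' : (#A : ℝ) ≤ 2 * #(A.erase 0) := by exact_mod_cast h'
    linarith
  have hA0 : (0 : ℝ) < #A := by exact_mod_cast (by omega : 0 < #A)
  have hvar := sq_incidences_sub_mean_le (L := A.erase 0 ×ˢ A)
    (fun l hl => ne_of_mem_erase (mem_product.1 hl).1) ((A + A) ×ˢ (A * A))
  have hinc := card_mul_card_le_sum_lineCount A (A.erase 0) (erase_subset _ _)
  simp only [card_product, Nat.cast_mul] at hvar hinc
  set q : ℝ := (Fintype.card F : ℝ)
  set n : ℝ := (#A : ℝ)
  set b : ℝ := (#(A.erase 0) : ℝ)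
  set T : ℝ := #(A + A) * #(A * A)
  have hb : 0 < b := by linarith
  by_contra! h
  obtain ⟨h₁, h₂⟩ := h
  rw [lt_div_iff₀ (by positivity)] at h₂
  have hmean : T * (b * n) / q ≤ b * n * n / 2 := by
    rw [div_le_iff₀ hq]
    have := mul_le_mul_of_nonneg_right h₁.le (mul_pos hb hA0).le
    linarith
  have hsq : (b * n * n / 2) ^ 2 ≤ T * (q * (b * n)) :=
    (pow_le_pow_left₀ (by positivity) (by linarith) 2).trans hvar
  have hsq' : b * n * (b * n ^ 3) ≤ b * n * (4 * (T * q)) := by linarith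
  have hle : b * n ^ 3 ≤ 4 * (T * q) := le_of_mul_le_mul_left hsq' (by positivity)
  have := mul_le_mul_of_nonneg_right hcard (pow_pos hA0 3).le
  linarith

end Incidence

theorem sum_product_estimate_finite_field :
    ∃ δ : ℝ, 0 < δ ∧
      ∀ (F : Type) [Field F] [Fintype F] [DecidableEq F]
        (A : Finset F), A.Nonempty →
          max (((A + A).card : ℝ)) (((A * A).card : ℝ))
            ≥ (A.card : ℝ) *
              min (δ * (((A.card : ℝ) ^ 2 / (Fintype.card F : ℝ)) ^ ((1 : ℝ) / 4)))
                  (δ * (((Fintype.card F : ℝ) / (A.card : ℝ)) ^ ((1 : ℝ) / 3))) := by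
  refine ⟨1 / 4, by norm_num, fun F _ _ _ A hA => ?_⟩
  have hq : (0 : ℝ) < Fintype.card F := by exact_mod_cast Fintype.card_pos
  have hn : (0 : ℝ) < #A := by exact_mod_cast hA.card_pos
  have hT : (#(A + A) * #(A * A) : ℝ) ≤ max (#(A + A) : ℝ) #(A * A) ^ 2 := by
    rw [sq]
    gcongr
    · exact le_max_left _ _
    · exact le_max_right _ _
  have hM : (#A : ℝ) ≤ max (#(A + A) : ℝ) #(A * A) := by
    refine le_max_of_le_left ?_
    exact_mod_cast card_le_card_add_right hA
  set M : ℝ := max (#(A + A) : ℝ) #(A * A)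
  have key : ∀ t e : ℝ, 1 ≤ t → 0 ≤ e → 2 * e ≤ 1 → (#A : ℝ) ^ 2 * t / 8 ≤ M ^ 2 →
      #A * (1 / 4 * t ^ e) ≤ M := by
    intro t e ht _ he h
    refine le_of_sq_le_sq ?_ (by linarith)
    have hpow : (t ^ e) ^ 2 ≤ t := by
      rw [← Real.rpow_mul_natCast (by linarith)]
      calc t ^ (e * (2 : ℕ)) ≤ t ^ (1 : ℝ) :=
            Real.rpow_le_rpow_of_exponent_le ht (by push_cast; linarith)
        _ = t := Real.rpow_one t
    have := mul_le_mul_of_nonneg_left hpow (sq_nonneg (#A : ℝ))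
    have : 0 ≤ (#A : ℝ) ^ 2 * t := by positivity
    linarith
  rcases le_or_gt ((#A : ℝ) ^ 2 / Fintype.card F) 1 with hsmall | hlarge
  · refine le_trans (mul_le_mul_of_nonneg_left (min_le_left _ _) hn.le) ?_
    have : ((#A : ℝ) ^ 2 / Fintype.card F) ^ ((1 : ℝ) / 4) ≤ 1 :=
      Real.rpow_le_one (by positivity) hsmall (by norm_num)
    have := mul_le_mul_of_nonneg_left this hn.le
    linarith
  · have htwo : 2 ≤ #A := by
      by_contra! h
      have hone : (#A : ℝ) ≤ 1 := by exact_mod_cast Nat.lt_succ_iff.1 h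
      have hqone : (1 : ℝ) ≤ Fintype.card F := by exact_mod_cast Fintype.card_pos
      rw [lt_div_iff₀ hq] at hlarge
      nlinarith
    rcases min_le_card_add_mul_card_mul htwo with h | h
    · refine le_trans (mul_le_mul_of_nonneg_left (min_le_right _ _) hn.le) ?_
      refine key _ _ ?_ (by norm_num) (by norm_num) ?_
      · rw [one_le_div hn]
        exact_mod_cast card_le_univ A
      · have : (#A : ℝ) ^ 2 * (Fintype.card F / #A) = Fintype.card F * #A := by field_simp
        have : 0 < (Fintype.card F * #A : ℝ) := by positivity
        linarith
    · refine le_trans (mul_le_mul_of_nonneg_left (min_le_left _ _) hn.le) ?_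
      refine key _ _ hlarge.le (by norm_num) (by norm_num) ?_
      have : (#A : ℝ) ^ 2 * ((#A : ℝ) ^ 2 / Fintype.card F) / 8 =
        (#A : ℝ) ^ 4 / (8 * Fintype.card F) := by field_simp
      linarith
end

section
/- Let A be a finite set of n ≥ 1 points in the Euclidean plane ℝ², and let Δ(A) := { dist(x,y) : x,y ∈ A, x ≠ y } be its set of distinct (Euclidean) distances. Then |Δ(A)| ≥ (√n − 2)/2. -/
open Finset

/-- Two circles in the plane with distinct centres share at most two points of a finite set. -/
theorem card_filter_dist_eq_and_dist_eq_le_two (A : Finset (EuclideanSpace ℝ (Fin 2)))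
    {p q : EuclideanSpace ℝ (Fin 2)} (hpq : p ≠ q) (b : ℝ × ℝ) :
    (A.filter fun x => (dist x p, dist x q) = b).card ≤ 2 := by
  by_contra! h
  obtain ⟨x, y, z, hx, hy, hz, hxy, hxz, hyz⟩ := Finset.two_lt_card_iff.mp h
  simp only [Finset.mem_filter, Prod.ext_iff] at hx hy hz
  rcases EuclideanGeometry.eq_of_dist_eq_of_dist_eq_of_finrank_eq_two (by simp) hpq hxy
    hx.2.1 hy.2.1 hz.2.1 hx.2.2 hy.2.2 hz.2.2 with h | h
  · exact hxz h.symm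
  · exact hyz h.symm

open scoped Classical in
theorem distinct_distances_lower_bound
    (A : Finset (EuclideanSpace ℝ (Fin 2))) (hA : 1 ≤ A.card) :
    ((((A ×ˢ A).filter fun p => p.1 ≠ p.2).image fun p => dist p.1 p.2).card : ℝ)
      ≥ (Real.sqrt (A.card) - 2) / 2 := by
  set D := ((A ×ˢ A).filter fun p => p.1 ≠ p.2).image fun p => dist p.1 p.2
  have hbound : A.card ≤ 2 * (D.card * D.card) + 2 := by
    rcases hA.eq_or_lt with h | h
    · omega
    obtain ⟨p, hp, q, hq, hpq⟩ := Finset.one_lt_card.mp h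
    have hmem : ∀ x ∈ A, ∀ y ∈ A, x ≠ y → dist x y ∈ D := fun x hx y hy hxy =>
      Finset.mem_image.mpr ⟨(x, y), by simp [hx, hy, hxy], rfl⟩
    have hmaps : ∀ x ∈ A \ {p, q}, (dist x p, dist x q) ∈ D ×ˢ D := by
      intro x hx
      simp only [Finset.mem_sdiff, Finset.mem_insert, Finset.mem_singleton, not_or] at hx
      exact Finset.mem_product.mpr ⟨hmem x hx.1 p hp hx.2.1, hmem x hx.1 q hq hx.2.2⟩
    have hcard := Finset.card_le_mul_card_image_of_maps_to hmaps 2 fun b _ => by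
      convert card_filter_dist_eq_and_dist_eq_le_two (A \ {p, q}) hpq b
    rw [Finset.card_product] at hcard
    have hsdiff := Finset.le_card_sdiff {p, q} A
    rw [Finset.card_pair hpq] at hsdiff
    omega
  have hbound' : (A.card : ℝ) ≤ 2 * (D.card * D.card) + 2 := by exact_mod_cast hbound
  have hsqrt : Real.sqrt A.card ≤ 2 * D.card + 2 := by
    refine Real.sqrt_le_iff.mpr ⟨by positivity, ?_⟩
    nlinarith [Nat.cast_nonneg (α := ℝ) D.card]
  linarith
end

section
/- Let F_q be a finite field, let d ≥ 1, and let P ∈ F_q[x₁,…,x_d] be a polynomial of total degree k ≥ 1. Assume that P cannot be written in the form P = Q(L), where Q ∈ F_q[z] is a one-variable polynomial and L ∈ F_q[x₁,…,x_d] is a polynomial of total degree at most 1. Then the number of elements a ∈ F_q for which the polynomial P − a has a factor of total degree exactly 1 in F_q[x₁,…,x_d] is at most k − 1. -/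
open MvPolynomial

/-- A polynomial of total degree at most one is an affine form. -/
lemma exists_eq_sum_add_C_of_totalDegree_le_one {σ F : Type*} [Fintype σ] [CommRing F]
    {L : MvPolynomial σ F} (hL : L.totalDegree ≤ 1) :
    ∃ (l : σ → F) (c : F), L = ∑ i, C (l i) * X i + C c := by
  have hsum : homogeneousComponent 0 L + homogeneousComponent 1 L = L := by
    conv_rhs => rw [← sum_homogeneousComponent L]
    rw [Finset.sum_subset (Finset.range_subset_range.2 (Nat.succ_le_succ hL))]
    · simp [Finset.sum_range_succ]
    · intro i _ hi
      exact homogeneousComponent_eq_zero _ _ (by simpa using hi)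
  have hspan : homogeneousComponent 1 L ∈
      Submodule.span F (Set.range (X : σ → MvPolynomial σ F)) := by
    rw [← homogeneousSubmodule_one_eq_span_X]
    exact homogeneousComponent_mem 1 L
  obtain ⟨l, hl⟩ := (Submodule.mem_span_range_iff_exists_fun F).1 hspan
  refine ⟨l, coeff 0 L, ?_⟩
  rw [← hsum, ← hl, homogeneousComponent_zero, add_comm]
  simp [smul_eq_C_mul, coeff_sum, coeff_C_mul]

/-- Two hyperplanes without a common point are parallel. -/
lemma exists_eq_C_mul_add_C_of_no_common_zero {σ F : Type*} [Fintype σ] [Field F]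
    {L M : MvPolynomial σ F} (hL : L.totalDegree = 1) (hM : M.totalDegree ≤ 1)
    (h : ∀ x, eval x L = 0 → eval x M ≠ 0) :
    ∃ u v : F, M = C u * L + C v := by
  classical
  obtain ⟨l, c, rfl⟩ := exists_eq_sum_add_C_of_totalDegree_le_one hL.le
  obtain ⟨m, e, rfl⟩ := exists_eq_sum_add_C_of_totalDegree_le_one hM
  obtain ⟨i, hi⟩ : ∃ i, l i ≠ 0 := by
    by_contra! hl
    simp [hl] at hL
  by_cases hprop : ∀ j, m j * l i = m i * l j
  · refine ⟨m i / l i, e - m i / l i * c, ?_⟩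
    have hm : ∀ j, m j = m i / l i * l j := fun j => by
      rw [div_mul_eq_mul_div, eq_div_iff hi, hprop j]
    rw [Finset.sum_congr rfl fun j _ => by rw [hm j, C_mul, mul_assoc], ← Finset.mul_sum]
    simp only [C_sub, C_mul]
    ring
  · push Not at hprop
    obtain ⟨j, hj⟩ := hprop
    obtain ⟨D, hD⟩ : ∃ D, D = m j * l i - m i * l j := ⟨_, rfl⟩
    have hD0 : D ≠ 0 := hD ▸ sub_ne_zero.2 hj
    have key : ∀ (n : σ → F) (b s t : F),
        eval (Pi.single i s + Pi.single j t) (∑ k, C (n k) * X k + C b)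
          = n i * s + n j * t + b := fun n b s t => by
      simp [mul_add, Finset.sum_add_distrib, Pi.single_apply]
    refine absurd ?_ (h (Pi.single i ((e * l j - c * m j) / D) +
      Pi.single j ((c * m i - e * l i) / D)) ?_)
    all_goals
      rw [key]
      field_simp
      rw [hD]
      ring

/-- If `P` is constant on at least `deg P` parallel hyperplanes, with distinct values, then it is
a polynomial in the form defining them. -/
lemma exists_eq_aeval_of_sub_C_dvd_sub_C {σ F : Type*} [Field F]
    {P L : MvPolynomial σ F} (hL : L.totalDegree = 1) (S : Finset F) (c : F → F)
    (hdvd : ∀ a ∈ S, L - C (c a) ∣ P - C a) (hP : P.totalDegree ≤ S.card) :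
    ∃ Q : Polynomial F, P = Polynomial.aeval L Q := by
  classical
  have hdeg : ∀ b, (L - C b).totalDegree = 1 := fun b => by
    rw [sub_eq_add_neg, ← C_neg, totalDegree_add_eq_left_of_totalDegree_lt (by simp [hL]), hL]
  have hc : Set.InjOn c S := by
    intro a ha b hb hab
    by_contra hne
    have h1 : L - C (c a) ∣ C (b - a) := by
      have := dvd_sub (hdvd a ha) (hab ▸ hdvd b hb)
      simpa using this
    have h2 := totalDegree_le_of_dvd_of_isDomain h1
      (C_ne_zero.2 (sub_ne_zero.2 (Ne.symm hne)))
    rw [hdeg, totalDegree_C] at h2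
    lia
  set I := Lagrange.interpolate S c id with hI
  have hdvdI : ∀ a ∈ S, L - C (c a) ∣ P - Polynomial.aeval L I := by
    intro a ha
    have h1 : Polynomial.X - Polynomial.C (c a) ∣ I - Polynomial.C a := by
      rw [Polynomial.dvd_iff_isRoot]
      rw [Polynomial.IsRoot, Polynomial.eval_sub, hI, Lagrange.eval_interpolate_at_node _ hc ha]
      simp
    have h2 : L - C (c a) ∣ Polynomial.aeval L I - C a := by
      simpa [algebraMap_eq] using map_dvd (Polynomial.aeval L) h1
    simpa using dvd_sub (hdvd a ha) h2
  have hcop : (S : Set F).Pairwise (Function.onFun IsCoprime fun a => L - C (c a)) := by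
    intro a ha b hb hab
    have hne : c b - c a ≠ 0 := sub_ne_zero.2 fun h => hab (hc ha hb h.symm)
    refine ⟨C (c b - c a)⁻¹, -C (c b - c a)⁻¹, ?_⟩
    have : (C (c b - c a)⁻¹ * C (c b - c a) : MvPolynomial σ F) = 1 := by
      rw [← C_mul, inv_mul_cancel₀ hne, C_1]
    rw [← this, C_sub]
    ring
  obtain ⟨R, hR⟩ := Finset.prod_dvd_of_coprime hcop hdvdI
  have hprod : ∀ T : Finset F, ∏ a ∈ T, (L - C (c a)) ≠ 0 ∧
      (∏ a ∈ T, (L - C (c a))).totalDegree = T.card := by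
    intro T
    induction T using Finset.induction_on with
    | empty => simp
    | insert a T ha ih =>
      have h0 : L - C (c a) ≠ 0 := fun h => by simpa [h] using hdeg (c a)
      rw [Finset.prod_insert ha, Finset.card_insert_of_notMem ha,
        totalDegree_mul_of_isDomain h0 ih.1, hdeg, ih.2, add_comm]
      exact ⟨mul_ne_zero h0 ih.1, rfl⟩
  have hIdeg : (Polynomial.aeval L I).totalDegree ≤ S.card := by
    rw [Polynomial.aeval_eq_sum_range]
    refine totalDegree_finsetSum_le fun i hi => (totalDegree_smul_le _ _).trans ?_
    refine (totalDegree_pow _ _).trans ?_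
    have hI_deg : I.natDegree ≤ S.card :=
      Polynomial.natDegree_le_of_degree_le (Lagrange.degree_interpolate_lt _ hc).le
    rw [hL, mul_one]
    exact (Nat.lt_succ_iff.1 (Finset.mem_range.1 hi)).trans hI_deg
  have hRdeg : R.totalDegree = 0 := by
    rcases eq_or_ne R 0 with rfl | h0
    · simp
    · have h1 := (totalDegree_sub P (Polynomial.aeval L I)).trans (max_le hP hIdeg)
      rw [hR, totalDegree_mul_of_isDomain (hprod S).1 h0, (hprod S).2] at h1
      lia
  rw [totalDegree_eq_zero_iff_eq_C] at hRdeg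
  refine ⟨I + (∏ a ∈ S, (Polynomial.X - Polynomial.C (c a))) * Polynomial.C (coeff 0 R), ?_⟩
  rw [sub_eq_iff_eq_add', hRdeg] at hR
  simpa [algebraMap_eq] using hR

theorem few_bad_shifts
    (F : Type) [Field F] [Fintype F] (d : ℕ) (hd : 1 ≤ d)
    (P : MvPolynomial (Fin d) F) (k : ℕ)
    (hk : P.totalDegree = k) (hk1 : 1 ≤ k)
    (hP : ¬ ∃ (Q : Polynomial F) (L : MvPolynomial (Fin d) F),
        L.totalDegree ≤ 1 ∧ P = Polynomial.aeval L Q) :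
    {a : F | ∃ L : MvPolynomial (Fin d) F,
        L.totalDegree = 1 ∧ L ∣ (P - MvPolynomial.C a)}.ncard ≤ k - 1 := by
  classical
  by_contra! hlt
  set A := {a : F | ∃ L : MvPolynomial (Fin d) F, L.totalDegree = 1 ∧ L ∣ (P - C a)} with hA
  obtain ⟨S, hS⟩ := A.toFinite.exists_finset_coe
  have hmem : ∀ a ∈ S, a ∈ A := fun a ha => hS ▸ Finset.mem_coe.2 ha
  rw [← hS, Set.ncard_coe_finset] at hlt
  obtain ⟨a₀, ha₀⟩ : S.Nonempty := Finset.card_pos.1 (by lia)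
  obtain ⟨L, hL, hLdvd⟩ := hmem a₀ ha₀
  have hshift : ∀ a ∈ S, ∃ c, L - C c ∣ P - C a := by
    intro a ha
    rcases eq_or_ne a a₀ with rfl | hne
    · exact ⟨0, by simpa using hLdvd⟩
    obtain ⟨M, hM, hMdvd⟩ := hmem a ha
    obtain ⟨u, v, huv⟩ := exists_eq_C_mul_add_C_of_no_common_zero hL hM.le fun x hx hx' => by
      have h1 := map_dvd (eval x) hLdvd
      have h2 := map_dvd (eval x) hMdvd
      rw [hx, zero_dvd_iff, map_sub, eval_C, sub_eq_zero] at h1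
      rw [hx', zero_dvd_iff, map_sub, eval_C, sub_eq_zero] at h2
      exact hne (h2.symm.trans h1)
    have hu : u ≠ 0 := by
      rintro rfl
      simp [huv] at hM
    refine ⟨-(v / u), dvd_trans ⟨C u, ?_⟩ hMdvd⟩
    rw [huv, sub_mul, ← C_mul, neg_mul, div_mul_cancel₀ _ hu, C_neg, sub_neg_eq_add, mul_comm]
  choose! c hc using hshift
  obtain ⟨Q, hQ⟩ := exists_eq_aeval_of_sub_C_dvd_sub_C hL S c hc (by lia)
  exact hP ⟨Q, L, hL.le, hQ⟩
end
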